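/- (Measure-level identity underlying Lemma 3.) Fix a player i, a time t ∈ {1,…,T-1}, a history a_{1:t} ∈ 𝒜^t and a type x^i ∈ 𝒳^i. Let β^i = (β^i_n)_{n=t}^T be any strategy of player i and let the other players use the equilibrium strategies β^{*,-i} from the forward recursion. Write π := π*_t[a_{1:t-1}], π' := π*_{t+1}[a_{1:t}], γ̃ := θ_t[π*_t[a_{1:t-1}]]. Assume π(x^i) := ∑_{x^{-i}} π(x^{-i},x^i) > 0, L(π,γ̃,a_t) > 0, γ̃^i(a^i_t|x^i) > 0, β^i_t(a^i_t|a_{1:t-1},x^i) > 0, and D := ∑_{x^{-i}} π(x^{-i},x^i)·∏_{j≠i} γ̃^j(a^j_t|x^j) > 0. Define μ(x^{-i}, a'_{t:T}) := (π(x^{-i},x^i)/π(x^i))·∏_{n=t}^T β^i_n(a'^i_n|a_{1:t-1}a'_{t:n-1},x^i)·∏_{j≠i} β^{*,j}_n(a'^j_n|a_{1:t-1}a'_{t:n-1},x^j). Then ∑_{x^{-i},a'_{t+1:T}} μ(x^{-i}, a_t a'_{t+1:T}) > 0 and for every x^{-i} and every a_{t+1:T}: μ(x^{-i}, a_{t:T})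 / ∑_{x'^{-i},a'_{t+1:T}} μ(x'^{-i}, a_t a'_{t+1:T}) = (π'(x^{-i},x^i)/π'(x^i)) · ∏_{n=t+1}^T β^i_n(a^i_n|a_{1:n-1},x^i)·∏_{j≠i} β^{*,j}_n(a^j_n|a_{1:n-1},x^j), where π'(x^i) := ∑_{x^{-i}} π'(x^{-i},x^i). -/

import Mathlib

open Finset

/-! ## Common setup

`N` players with private types `X i` and actions `A i`, all nonempty and finite.
A history is a `List (∀ i, A i)` of past joint actions in chronological order;
the kernel used at time `n` is the one applied to histories of length `n - 1`. -/

noncomputable section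

variable {N : ℕ} {X A : Fin N → Type*}

/-- Combine player `i`'s private type `xi` with the profile `xm` of the other
players' private types into a full type profile `x = (x^i, x^{-i})`. -/
def combine (i : Fin N) (xi : X i) (xm : ∀ j : {j : Fin N // j ≠ i}, X j.1)
    (j : Fin N) : X j :=
  if h : j = i then h.symm ▸ xi else xm ⟨j, h⟩

section

variable [∀ i, Fintype (X i)] [∀ i, Fintype (A i)]

/-- `π` is a belief on the product type: nonnegative and summing to one. -/
def IsBelief (π : (∀ i, X i) → ℝ) : Prop :=
  (∀ x, 0 ≤ π x) ∧ ∑ x, π x = 1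

/-- `γ` is a prescription profile: each `γ i (x^i)` is a probability vector on `A i`. -/
def IsPresc (γ : ∀ i, X i → A i → ℝ) : Prop :=
  ∀ i xi, (∀ ai, 0 ≤ γ i xi ai) ∧ ∑ ai, γ i xi ai = 1

/-- `σi` is a behavioral strategy kernel of player `i`: for each history and
private type, a probability vector on `A i`. -/
def IsKernel (i : Fin N) (σi : List (∀ j, A j) → X i → A i → ℝ) : Prop :=
  ∀ h xi, (∀ ai, 0 ≤ σi h xi ai) ∧ ∑ ai, σi h xi ai = 1

/-- Likelihood `L(π,γ,a) = ∑_x π(x) ∏_i γ^i(a^i|x^i)`. -/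
def like (π : (∀ i, X i) → ℝ) (γ : ∀ i, X i → A i → ℝ) (a : ∀ i, A i) : ℝ :=
  ∑ x, π x * ∏ i, γ i (x i) (a i)

/-- Belief update `F(π,γ,a)`: Bayes' rule when the likelihood is positive,
and `π` itself otherwise. -/
def bUpdate (π : (∀ i, X i) → ℝ) (γ : ∀ i, X i → A i → ℝ) (a : ∀ i, A i) :
    (∀ i, X i) → ℝ :=
  if 0 < like π γ a then fun x => π x * (∏ i, γ i (x i) (a i)) / like π γ a else π

/-- Marginal probability `π(x^i)` of player `i`'s type `xi` under belief `π`. -/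
def marginal (π : (∀ i, X i) → ℝ) (i : Fin N) (xi : X i) : ℝ :=
  ∑ xm : ∀ j : {j : Fin N // j ≠ i}, X j.1, π (combine i xi xm)

end

end
section

variable {N : ℕ} {X A : Fin N → Type*}
variable [∀ i, Fintype (X i)] [∀ i, Fintype (A i)]

/-- Forward recursion of the common belief: `piStar θ t π h` is the belief obtained
from belief `π` at time `t` after observing the joint-action history `h`, using the
equilibrium generating function `θ`.  Thus `piStar θ 1 Q h = π*_{|h|+1}[h]`. -/
noncomputable def piStar (θ : ℕ → ((∀ i, X i) → ℝ) → ∀ i, X i → A i → ℝ) :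
    ℕ → ((∀ i, X i) → ℝ) → List (∀ i, A i) → (∀ i, X i) → ℝ
  | _, π, [] => π
  | t, π, a :: h => piStar θ (t + 1) (bUpdate π (θ t π) a) h

/-- Equilibrium strategy `β*` from the forward recursion:
`β*^j_t(a^j|a_{1:t-1},x^j) = θ_t[π*_t[a_{1:t-1}]]^j(a^j|x^j)` where `t - 1` is the
length of the history. -/
noncomputable def betaStar (θ : ℕ → ((∀ i, X i) → ℝ) → ∀ i, X i → A i → ℝ)
    (Q : (∀ i, X i) → ℝ) (j : Fin N) (h : List (∀ i, A i)) (xj : X j) (aj : A j) : ℝ :=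
  θ (h.length + 1) (piStar θ 1 Q h) j xj aj

/-- The strategy profile in which player `i` uses `βi` and every other player `j`
uses `σ j`. -/
def unilateral (i : Fin N) (βi : List (∀ j, A j) → X i → A i → ℝ)
    (σ : ∀ j, List (∀ k, A k) → X j → A j → ℝ) (j : Fin N) :
    List (∀ k, A k) → X j → A j → ℝ :=
  if h : j = i then (fun hist xj aj => βi hist (h ▸ xj) (h ▸ aj)) else σ j

/-- Probability weight of a future joint-action path `f` of length `m` following the
history `h`, given the state `x`, under the strategy profile `σ`:
`∏_k ∏_j σ^j(f_k^j | h f_{0:k-1}, x^j)`. -/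
def pathWeight (σ : ∀ j, List (∀ k, A k) → X j → A j → ℝ)
    (h : List (∀ k, A k)) (x : ∀ j, X j) {m : ℕ} (f : Fin m → ∀ k, A k) : ℝ :=
  ∏ k : Fin m, ∏ j, σ j (h ++ (List.ofFn f).take (k : ℕ)) (x j) (f k j)

/-- Total reward of player `i` along the action path `f`, starting at time `s`:
`∑_{n=s}^{s+m-1} R^i_n(x, a_n)`. -/
def rewardSum (R : Fin N → ℕ → (∀ j, X j) → (∀ j, A j) → ℝ)
    (i : Fin N) (s : ℕ) (x : ∀ j, X j) {m : ℕ} (f : Fin m → ∀ j, A j) : ℝ :=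
  ∑ k : Fin m, R i (s + (k : ℕ)) x (f k)

/-- The conditional measure on `(x^{-i}, future actions)` given `(h, x^i)`:
root belief `π(x^{-i}|x^i)` times the path weight under `σ`. -/
noncomputable def muMeas (π : (∀ j, X j) → ℝ)
    (σ : ∀ j, List (∀ k, A k) → X j → A j → ℝ)
    (h : List (∀ k, A k)) (i : Fin N) (xi : X i)
    (xm : ∀ j : {j : Fin N // j ≠ i}, X j.1) {m : ℕ} (f : Fin m → ∀ k, A k) : ℝ :=
  (π (combine i xi xm) / marginal π i xi) * pathWeight σ h (combine i xi xm) f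

/-- Conditional expected reward-to-go of player `i` from time `s` over `m` stages,
given history `h` and own type `xi`, with root belief `π` and strategy profile `σ`:
`E^{σ,π}[∑_{n=s}^{s+m-1} R^i_n | h, x^i]`. -/
noncomputable def condExp (R : Fin N → ℕ → (∀ j, X j) → (∀ j, A j) → ℝ)
    (i : Fin N) (s m : ℕ) (π : (∀ j, X j) → ℝ)
    (σ : ∀ j, List (∀ k, A k) → X j → A j → ℝ)
    (h : List (∀ k, A k)) (xi : X i) : ℝ :=
  ∑ xm : ∀ j : {j : Fin N // j ≠ i}, X j.1, ∑ f : Fin m → ∀ k, A k,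
    muMeas π σ h i xi xm f * rewardSum R i s (combine i xi xm) f

/-- Stage objective `W(γ^i)` of the backward recursion at time `t`, belief `π`,
player `i` with type `xi`, when player `i` uses the probability vector `p` on `A i`
and the others use the prescriptions `γt`. -/
noncomputable def stageW (R : Fin N → ℕ → (∀ j, X j) → (∀ j, A j) → ℝ)
    (V : ∀ i : Fin N, ℕ → ((∀ j, X j) → ℝ) → X i → ℝ) (t : ℕ)
    (π : (∀ j, X j) → ℝ) (γt : ∀ j, X j → A j → ℝ) (i : Fin N) (xi : X i)
    (p : A i → ℝ) : ℝ :=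
  ∑ xm : ∀ j : {j : Fin N // j ≠ i}, X j.1, ∑ a : ∀ j, A j,
    (π (combine i xi xm) / marginal π i xi) * p (a i) *
      (∏ j ∈ Finset.univ.erase i, γt j (combine i xi xm j) (a j)) *
      (R i t (combine i xi xm) a + V i (t + 1) (bUpdate π γt a) xi)

/-- The backward-recursion conditions on the value functions `V` and equilibrium
generating function `θ`: `V^i_{T+1} ≡ 0`, and at every time `t ∈ {1,…,T}`, belief
`π`, player `i` and type `xi` of positive marginal, the prescription `θ t π i xi`
maximizes the stage objective among probability vectors on `A i`, and `V^i_t(π,x^i)`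
is the corresponding maximum value. -/
noncomputable def BackwardOK (T : ℕ)
    (R : Fin N → ℕ → (∀ j, X j) → (∀ j, A j) → ℝ)
    (V : ∀ i : Fin N, ℕ → ((∀ j, X j) → ℝ) → X i → ℝ)
    (θ : ℕ → ((∀ j, X j) → ℝ) → ∀ j, X j → A j → ℝ) : Prop :=
  (∀ i π xi, V i (T + 1) π xi = 0) ∧
  ∀ t, 1 ≤ t → t ≤ T → ∀ π : (∀ j, X j) → ℝ, IsBelief π →
    ∀ i xi, 0 < marginal π i xi →
      (∀ p : A i → ℝ, (∀ ai, 0 ≤ p ai) → (∑ ai, p ai) = 1 →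
        stageW R V t π (θ t π) i xi p ≤ stageW R V t π (θ t π) i xi (θ t π i xi)) ∧
      V i t π xi = stageW R V t π (θ t π) i xi (θ t π i xi)

end

section

variable {N : ℕ} {X A : Fin N → Type*}

@[simp]
theorem combine_self (i : Fin N) (xi : X i) (xm : ∀ j : {j : Fin N // j ≠ i}, X j.1) :
    combine i xi xm i = xi := by
  simp [combine]

theorem unilateral_self (i : Fin N) (βi : List (∀ j, A j) → X i → A i → ℝ)
    (σ : ∀ j, List (∀ k, A k) → X j → A j → ℝ) : unilateral i βi σ i = βi := by
  simp [unilateral]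

theorem unilateral_of_ne {i j : Fin N} (hj : j ≠ i) (βi : List (∀ j, A j) → X i → A i → ℝ)
    (σ : ∀ j, List (∀ k, A k) → X j → A j → ℝ) : unilateral i βi σ j = σ j := by
  simp [unilateral, hj]

theorem pathWeight_cons (σ : ∀ j, List (∀ k, A k) → X j → A j → ℝ)
    (h : List (∀ k, A k)) (x : ∀ j, X j) {m : ℕ} (a : ∀ k, A k) (g : Fin m → ∀ k, A k) :
    pathWeight σ h x (Fin.cons a g : Fin (m + 1) → ∀ k, A k) =
      (∏ j, σ j h (x j) (a j)) * pathWeight σ (h ++ [a]) x g := by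
  simp [pathWeight, Fin.prod_univ_succ, List.ofFn_succ]

theorem sum_pathWeight [∀ i, Fintype (A i)]
    {σ : ∀ j, List (∀ k, A k) → X j → A j → ℝ}
    (hσ : ∀ j h xj, ∑ a, σ j h xj a = 1) (h : List (∀ k, A k)) (x : ∀ j, X j) (m : ℕ) :
    ∑ g : Fin m → ∀ k, A k, pathWeight σ h x g = 1 := by
  induction m generalizing h with
  | zero => simp [pathWeight]
  | succ m ih =>
    rw [← (Fin.consEquiv fun _ : Fin (m + 1) => ∀ k, A k).sum_comp, Fintype.sum_prod_type]
    change ∑ a, ∑ g, pathWeight σ h x (Fin.cons a g : Fin (m + 1) → ∀ k, A k) = 1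
    simp only [pathWeight_cons, ← Finset.mul_sum, ih, mul_one]
    rw [← Fintype.prod_sum]
    simp [hσ]

variable [∀ i, Fintype (X i)]

theorem piStar_append_singleton (θ : ℕ → ((∀ i, X i) → ℝ) → ∀ i, X i → A i → ℝ)
    (t : ℕ) (π : (∀ i, X i) → ℝ) (h : List (∀ i, A i)) (a : ∀ i, A i) :
    piStar θ t π (h ++ [a]) =
      bUpdate (piStar θ t π h) (θ (t + h.length) (piStar θ t π h)) a := by
  induction h generalizing t π with
  | nil => simp [piStar]
  | cons b h ih =>
    simp only [List.cons_append, piStar, ih, List.length_cons]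
    rw [add_right_comm, add_assoc]

theorem sum_unilateral_betaStar [∀ i, Fintype (A i)]
    {θ : ℕ → ((∀ j, X j) → ℝ) → ∀ j, X j → A j → ℝ}
    (hθ : ∀ t π, IsPresc (θ t π)) (Q : (∀ j, X j) → ℝ) {i : Fin N}
    {βi : List (∀ j, A j) → X i → A i → ℝ} (hβi : IsKernel i βi)
    (j : Fin N) (h : List (∀ j, A j)) (xj : X j) :
    ∑ a, unilateral i βi (betaStar θ Q) j h xj a = 1 := by
  by_cases hj : j = i
  · subst hj
    simpa only [unilateral_self] using (hβi h xj).2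
  · simpa only [unilateral_of_ne hj, betaStar] using (hθ _ _ j xj).2

/-- Bayes' rule, conditionally on player `i`'s type: the factor contributed by player `i`
cancels. -/
theorem bUpdate_div_marginal {π : (∀ j, X j) → ℝ} {γ : ∀ j, X j → A j → ℝ} {a : ∀ j, A j}
    (hL : 0 < like π γ a) {i : Fin N} {xi : X i} (hγ : 0 < γ i xi (a i))
    (xm : ∀ j : {j : Fin N // j ≠ i}, X j.1) :
    bUpdate π γ a (combine i xi xm) / marginal (bUpdate π γ a) i xi =
      (π (combine i xi xm) * ∏ j ∈ Finset.univ.erase i, γ j (combine i xi xm j) (a j)) /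
        ∑ xm' : ∀ j : {j : Fin N // j ≠ i}, X j.1, π (combine i xi xm') *
          ∏ j ∈ Finset.univ.erase i, γ j (combine i xi xm' j) (a j) := by
  have key (xm : ∀ j : {j : Fin N // j ≠ i}, X j.1) : bUpdate π γ a (combine i xi xm) =
      γ i xi (a i) / like π γ a * (π (combine i xi xm) *
        ∏ j ∈ Finset.univ.erase i, γ j (combine i xi xm j) (a j)) := by
    rw [bUpdate, if_pos hL, ← Finset.mul_prod_erase _ _ (Finset.mem_univ i), combine_self]
    ring
  simp only [marginal, key, ← Finset.mul_sum]
  exact mul_div_mul_left _ _ (div_pos hγ hL).ne'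

end

/-- **measure-level identity underlying Lemma 3.**
Fix a player `i`, a time `t ∈ {1,…,T-1}`, a history `a_{1:t-1}` (the list `h`),
the realized action `a_t` and a type `x^i`.  Player `i` uses an arbitrary strategy
`β^i` and the others use the equilibrium strategies `β^{*,-i}` of the forward
recursion.  Write `π = π*_t[a_{1:t-1}]`, `π' = π*_{t+1}[a_{1:t}]`,
`γ̃ = θ_t[π*_t[a_{1:t-1}]]`.  Under the stated positivity assumptions, the measure
`μ(x^{-i}, a'_{t:T}) = π(x^{-i}|x^i)·∏_{n=t}^T β^i_n(a'^i_n|·)∏_{j≠i} β^{*,j}_n(a'^j_n|·)`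
has positive mass on `{a'_t = a_t}`, and conditioning it on the realized `a_t`
yields `π'(x^{-i}|x^i)` times the path weight of `a_{t+1:T}` from time `t+1`. -/
theorem mu_conditional_identity {N T : ℕ} {X A : Fin N → Type*}
    [∀ i, Fintype (X i)] [∀ i, Nonempty (X i)]
    [∀ i, Fintype (A i)] [∀ i, Nonempty (A i)]
    (R : Fin N → ℕ → (∀ j, X j) → (∀ j, A j) → ℝ)
    (V : ∀ i : Fin N, ℕ → ((∀ j, X j) → ℝ) → X i → ℝ)
    (θ : ℕ → ((∀ j, X j) → ℝ) → ∀ j, X j → A j → ℝ)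
    (Q : (∀ j, X j) → ℝ) (hQ : IsBelief Q)
    (hθ : ∀ t π, IsPresc (θ t π)) (hBO : BackwardOK T R V θ)
    (i : Fin N) (t : ℕ) (h1 : 1 ≤ t) (h2 : t + 1 ≤ T)
    (h : List (∀ j, A j)) (hlen : h.length = t - 1)
    (at_ : ∀ j, A j) (xi : X i)
    (βi : List (∀ j, A j) → X i → A i → ℝ) (hβi : IsKernel i βi)
    (hmarg : 0 < marginal (piStar θ 1 Q h) i xi)
    (hL : 0 < like (piStar θ 1 Q h) (θ t (piStar θ 1 Q h)) at_)
    (hγ : 0 < θ t (piStar θ 1 Q h) i xi (at_ i))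
    (hβ : 0 < βi h xi (at_ i))
    (hD : 0 < ∑ xm : ∀ j : {j : Fin N // j ≠ i}, X j.1,
        piStar θ 1 Q h (combine i xi xm) *
          ∏ j ∈ Finset.univ.erase i,
            θ t (piStar θ 1 Q h) j (combine i xi xm j) (at_ j)) :
    (0 < ∑ xm : ∀ j : {j : Fin N // j ≠ i}, X j.1, ∑ g : Fin (T - t) → ∀ j, A j,
        muMeas (piStar θ 1 Q h) (unilateral i βi (betaStar θ Q)) h i xi xm
          (Fin.cons at_ g)) ∧
    ∀ (xm : ∀ j : {j : Fin N // j ≠ i}, X j.1) (g : Fin (T - t) → ∀ j, A j),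
      muMeas (piStar θ 1 Q h) (unilateral i βi (betaStar θ Q)) h i xi xm
          (Fin.cons at_ g) /
        (∑ xm' : ∀ j : {j : Fin N // j ≠ i}, X j.1, ∑ g' : Fin (T - t) → ∀ j, A j,
          muMeas (piStar θ 1 Q h) (unilateral i βi (betaStar θ Q)) h i xi xm'
            (Fin.cons at_ g')) =
      (piStar θ 1 Q (h ++ [at_]) (combine i xi xm) /
          marginal (piStar θ 1 Q (h ++ [at_])) i xi) *
        pathWeight (unilateral i βi (betaStar θ Q)) (h ++ [at_])
          (combine i xi xm) g := by
  set π := piStar θ 1 Q h with hπ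
  have ht : h.length + 1 = t := by omega
  have hmu (xm : ∀ j : {j : Fin N // j ≠ i}, X j.1) (g : Fin (T - t) → ∀ j, A j) :
      muMeas π (unilateral i βi (betaStar θ Q)) h i xi xm (Fin.cons at_ g) =
        βi h xi (at_ i) / marginal π i xi * (π (combine i xi xm) *
          ∏ j ∈ Finset.univ.erase i, θ t π j (combine i xi xm j) (at_ j)) *
          pathWeight (unilateral i βi (betaStar θ Q)) (h ++ [at_]) (combine i xi xm) g := by
    have hprod : ∏ j ∈ Finset.univ.erase i,
        unilateral i βi (betaStar θ Q) j h (combine i xi xm j) (at_ j) =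
          ∏ j ∈ Finset.univ.erase i, θ t π j (combine i xi xm j) (at_ j) := by
      refine Finset.prod_congr rfl fun j hj => ?_
      rw [unilateral_of_ne (Finset.ne_of_mem_erase hj), betaStar, ht]
    rw [muMeas, pathWeight_cons, ← Finset.mul_prod_erase _ _ (Finset.mem_univ i), hprod,
      unilateral_self, combine_self]
    ring
  have hc : 0 < βi h xi (at_ i) / marginal π i xi := div_pos hβ hmarg
  simp only [hmu, ← Finset.mul_sum, sum_pathWeight (sum_unilateral_betaStar hθ Q hβi), mul_one]
  refine ⟨mul_pos hc hD, fun xm g => ?_⟩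
  rw [piStar_append_singleton, ← hπ, add_comm 1, ht, bUpdate_div_marginal hL hγ, mul_assoc,
    mul_div_mul_left _ _ hc.ne', div_mul_eq_mul_div]
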